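/- arXiv:cs/0503052 — 2 statements merged into one kernel-verified Lean document; each statement's English description precedes it below -/
import Mathlib

section
/- Let d ∈ ℤ⁺ and A ⊆ ℤ^d. If Dim_ζ(A) < 1, then no infinite subset of A is boundedly connected. -/
open Filter

/-- Euclidean norm of a point of `ℤ^d`. -/
noncomputable def znorm {d : ℕ} (v : Fin d → ℤ) : ℝ :=
  Real.sqrt (∑ i, ((v i : ℝ)) ^ 2)

/-- The zeta-dimension of a set `A ⊆ ℤ^d`:
`Dim_ζ(A) = inf { s ∈ [0,∞) : Σ_{0 ≠ n⃗ ∈ A} ‖n⃗‖^{-s} < ∞ }`. -/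
noncomputable def zetaDimZ {d : ℕ} (A : Set (Fin d → ℤ)) : ℝ :=
  sInf {s : ℝ | 0 ≤ s ∧
    (∑' v : ↥(A \ {0}), ENNReal.ofReal (znorm (v : Fin d → ℤ)) ^ (-s)) < ⊤}

/-- `C ⊆ ℤ^d` is boundedly connected if there is an `r ∈ ℤ⁺` such that any two points
of `C` are joined by an `r`-path all of whose points lie in `C`. -/
def BoundedlyConnected {d : ℕ} (C : Set (Fin d → ℤ)) : Prop :=
  ∃ r : ℕ, 0 < r ∧ ∀ m ∈ C, ∀ n ∈ C, ∃ l : ℕ, ∃ p : Fin (l + 1) → (Fin d → ℤ),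
    p 0 = m ∧ p (Fin.last l) = n ∧ (∀ i, p i ∈ C) ∧
      ∀ i : Fin l, znorm (p i.castSucc - p i.succ) ≤ (r : ℝ)

/-- The inclusion of `ℤ^d` into Euclidean space. -/
noncomputable def castEuclidean {d : ℕ} (v : Fin d → ℤ) : EuclideanSpace ℝ (Fin d) :=
  WithLp.toLp 2 fun i => (v i : ℝ)

theorem norm_castEuclidean {d : ℕ} (v : Fin d → ℤ) : ‖castEuclidean v‖ = znorm v := by
  simp [castEuclidean, znorm, EuclideanSpace.norm_eq]

theorem castEuclidean_injective {d : ℕ} :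
    Function.Injective (castEuclidean : (Fin d → ℤ) → EuclideanSpace ℝ (Fin d)) := by
  intro v w h
  ext i
  have := congrArg (fun x : EuclideanSpace ℝ (Fin d) => x i) h
  simpa [castEuclidean] using this

theorem znorm_nonneg {d : ℕ} (v : Fin d → ℤ) : 0 ≤ znorm v := Real.sqrt_nonneg _

theorem znorm_zero {d : ℕ} : znorm (0 : Fin d → ℤ) = 0 := by simp [znorm]

theorem znorm_pos {d : ℕ} {v : Fin d → ℤ} (hv : v ≠ 0) : 0 < znorm v := by
  rw [← norm_castEuclidean, norm_pos_iff]
  intro h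
  exact hv (castEuclidean_injective (h.trans (by ext i; simp [castEuclidean])))

theorem znorm_le_add_znorm_sub {d : ℕ} (v w : Fin d → ℤ) : znorm w ≤ znorm v + znorm (v - w) := by
  have h : castEuclidean (v - w) = castEuclidean v - castEuclidean w := by
    ext i; simp [castEuclidean]
  rw [← norm_castEuclidean, ← norm_castEuclidean v, ← norm_castEuclidean (v - w), h]
  exact norm_le_norm_add_norm_sub _ _

theorem abs_apply_le_znorm {d : ℕ} (v : Fin d → ℤ) (i : Fin d) : |(v i : ℝ)| ≤ znorm v := by
  rw [← norm_castEuclidean]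
  simpa [castEuclidean] using PiLp.norm_apply_le (castEuclidean v) i

theorem finite_setOf_znorm_le {d : ℕ} (B : ℝ) : {v : Fin d → ℤ | znorm v ≤ B}.Finite := by
  refine (Set.finite_Icc (fun _ : Fin d => -⌈B⌉) (fun _ => ⌈B⌉)).subset fun v hv => ?_
  have key : ∀ i, |v i| ≤ ⌈B⌉ := fun i => by
    have : (|v i| : ℝ) ≤ ⌈B⌉ :=
      (abs_apply_le_znorm v i).trans (le_trans hv (Int.le_ceil B))
    exact_mod_cast this
  exact ⟨fun i => (abs_le.1 (key i)).1, fun i => (abs_le.1 (key i)).2⟩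

theorem exists_summable_znorm_rpow_neg (d : ℕ) :
    ∃ s : ℝ, 0 ≤ s ∧ Summable fun v : Fin d → ℤ => znorm v ^ (-s) := by
  let L := Submodule.span ℤ (Set.range (EuclideanSpace.basisFun (Fin d) ℝ).toBasis)
  have hmem : ∀ v : Fin d → ℤ, castEuclidean v ∈ L := fun v => by
    rw [Module.Basis.mem_span_iff_repr_mem]
    intro i
    exact ⟨v i, by simp [castEuclidean]⟩
  refine ⟨Module.finrank ℤ L + 1, by positivity, ?_⟩
  have hs := ZLattice.summable_norm_rpow L (-(Module.finrank ℤ L + 1 : ℝ)) (by linarith)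
  have hinj : Function.Injective fun v : Fin d → ℤ => (⟨castEuclidean v, hmem v⟩ : L) :=
    fun v w h => castEuclidean_injective (congrArg Subtype.val h)
  refine (hs.comp_injective hinj).congr fun v => ?_
  simp [norm_castEuclidean]

theorem ofReal_znorm_rpow {d : ℕ} {A : Set (Fin d → ℤ)} (s : ℝ) (v : ↥(A \ {0})) :
    ENNReal.ofReal (znorm (v : Fin d → ℤ)) ^ s = ENNReal.ofReal (znorm (v : Fin d → ℤ) ^ s) :=
  ENNReal.ofReal_rpow_of_pos (znorm_pos v.2.2)

theorem tsum_znorm_lt_top_iff_summable {d : ℕ} (A : Set (Fin d → ℤ)) (s : ℝ) :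
    (∑' v : ↥(A \ {0}), ENNReal.ofReal (znorm (v : Fin d → ℤ)) ^ s) < ⊤ ↔
      Summable fun v : ↥(A \ {0}) => znorm (v : Fin d → ℤ) ^ s := by
  simp_rw [ofReal_znorm_rpow]
  refine ⟨fun h => (ENNReal.summable_toReal h.ne).congr fun v => ?_, fun h => ?_⟩
  · exact ENNReal.toReal_ofReal (Real.rpow_nonneg (znorm_nonneg _) _)
  · exact h.tsum_ofReal_lt_top

theorem exists_summable_of_zetaDimZ_lt {d : ℕ} {A : Set (Fin d → ℤ)} {t : ℝ} (h : zetaDimZ A < t) :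
    ∃ s, 0 ≤ s ∧ s < t ∧ Summable fun v : ↥(A \ {0}) => znorm (v : Fin d → ℤ) ^ (-s) := by
  obtain ⟨s₀, hs₀, hsum⟩ := exists_summable_znorm_rpow_neg d
  have hne : {s : ℝ | 0 ≤ s ∧
      (∑' v : ↥(A \ {0}), ENNReal.ofReal (znorm (v : Fin d → ℤ)) ^ (-s)) < ⊤}.Nonempty :=
    ⟨s₀, hs₀, (tsum_znorm_lt_top_iff_summable A (-s₀)).2 (hsum.subtype _)⟩
  obtain ⟨s, ⟨hs, hlt⟩, hst⟩ := exists_lt_of_csInf_lt hne h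
  exact ⟨s, hs, hst, (tsum_znorm_lt_top_iff_summable A (-s)).1 hlt⟩

/-- A path with steps of length at most `r` that crosses the sphere of radius `B` outwards has a
point whose norm is in `(B, B + r]`. -/
theorem exists_path_point_znorm_mem_Ioc {d l : ℕ} {r B : ℝ} (p : Fin (l + 1) → (Fin d → ℤ))
    (hp : ∀ i : Fin l, znorm (p i.castSucc - p i.succ) ≤ r) (h₀ : znorm (p 0) ≤ B)
    (hl : B < znorm (p (Fin.last l))) : ∃ i, znorm (p i) ∈ Set.Ioc B (B + r) := by
  by_contra! hne
  have key : ∀ i, znorm (p i) ≤ B := by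
    intro i
    induction i using Fin.induction with
    | zero => exact h₀
    | succ i ih =>
      by_contra! hB
      exact hne i.succ ⟨hB, by linarith [znorm_le_add_znorm_sub (p i.castSucc) (p i.succ), hp i]⟩
  exact absurd (key _) hl.not_ge

theorem BoundedlyConnected.exists_znorm_mem_Ioc {d : ℕ} {C : Set (Fin d → ℤ)}
    (hC : BoundedlyConnected C) (hinf : C.Infinite) :
    ∃ R r : ℝ, 0 ≤ R ∧ 0 < r ∧ ∀ B ≥ R, ∃ v ∈ C, znorm v ∈ Set.Ioc B (B + r) := by
  obtain ⟨r, hr, hpath⟩ := hC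
  obtain ⟨m, hm⟩ := hinf.nonempty
  refine ⟨znorm m, r, znorm_nonneg m, by exact_mod_cast hr, fun B hB => ?_⟩
  obtain ⟨n, hn, hnB⟩ := hinf.exists_notMem_finite (finite_setOf_znorm_le B)
  obtain ⟨l, p, rfl, rfl, hpC, hp⟩ := hpath m hm n hn
  obtain ⟨i, hi⟩ := exists_path_point_znorm_mem_Ioc p hp hB (not_le.1 hnB)
  exact ⟨p i, hpC i, hi⟩

theorem zetaDimZ_lt_one_totally_disconnected {d : ℕ} (hd : 0 < d)
    (A : Set (Fin d → ℤ)) (h : zetaDimZ A < 1) :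
    ∀ C ⊆ A, C.Infinite → ¬ BoundedlyConnected C := by
  intro C hCA hinf hC
  obtain ⟨s, hs, hs1, hsum⟩ := exists_summable_of_zetaDimZ_lt h
  obtain ⟨R, r, hR, hr, hshell⟩ := hC.exists_znorm_mem_Ioc hinf
  choose f hfC hf using fun k : ℕ =>
    hshell (R + k * r) (le_add_of_nonneg_right (by positivity))
  have hpos : ∀ k, 0 < znorm (f k) := fun k => lt_of_le_of_lt (by positivity) (hf k).1
  have hmono : StrictMono fun k => znorm (f k) := strictMono_nat_of_lt_succ fun k => by
    have := (hf (k + 1)).1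
    push_cast at this
    linarith [(hf k).2]
  have hmem : ∀ k, f k ∈ A \ {0} := fun k =>
    ⟨hCA (hfC k), fun h0 => (hpos k).ne' (by rw [h0, znorm_zero])⟩
  have hinj : Function.Injective fun k => (⟨f k, hmem k⟩ : ↥(A \ {0})) := fun j k hjk =>
    hmono.injective (congrArg (fun v : ↥(A \ {0}) => znorm (v : Fin d → ℤ)) hjk)
  have hlower : ∀ k : ℕ, (R + r) ^ (-s) * ((k + 1 : ℕ) : ℝ) ^ (-s) ≤ znorm (f k) ^ (-s) := by
    intro k
    rw [← Real.mul_rpow (by positivity) (by positivity)]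
    refine Real.rpow_le_rpow_of_nonpos (hpos k) ((hf k).2.trans ?_) (by linarith)
    push_cast
    nlinarith [mul_nonneg hR (Nat.cast_nonneg (α := ℝ) k)]
  have hsum' : Summable fun k : ℕ => (R + r) ^ (-s) * ((k + 1 : ℕ) : ℝ) ^ (-s) :=
    (hsum.comp_injective hinj).of_nonneg_of_le (fun k => by positivity) hlower
  rw [summable_mul_left_iff (by positivity),
    summable_nat_add_iff (f := fun k : ℕ => (k : ℝ) ^ (-s)) 1, Real.summable_nat_rpow] at hsum'
  linarith
end

section
/- Let Σ = {0, 1, …, k−1} with k ≥ 2. If Γ ⊆ Σ and Γ ⊄ {0}, and A = { n ∈ ℤ⁺ : every symbol of rep_k(n) lies in Γ }, then Dim_ζ(A) = ln|Γ| / ln k. -/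
/-- The zeta-dimension of a set of positive integers:
`Dim_ζ(A) = inf { s ∈ [0,∞) : Σ_{n ∈ A} n^{-s} < ∞ }`. -/
noncomputable def zetaDim (A : Set ℕ+) : ℝ :=
  sInf {s : ℝ | 0 ≤ s ∧ (∑' n : A, (((n : ℕ+) : ℕ) : ENNReal) ^ (-s)) < ⊤}

/-- The natural numbers with exactly `L + 1` base-`k` digits, all of them in `Γ`. -/
def digitLevel (k : ℕ) (Γ : Finset ℕ) (L : ℕ) : Finset ℕ :=
  {n ∈ Finset.Ico (k ^ L) (k ^ (L + 1)) | ∀ c ∈ Nat.digits k n, c ∈ Γ}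

theorem mem_digitLevel {k : ℕ} {Γ : Finset ℕ} {L n : ℕ} :
    n ∈ digitLevel k Γ L ↔
      (k ^ L ≤ n ∧ n < k ^ (L + 1)) ∧ ∀ c ∈ Nat.digits k n, c ∈ Γ := by
  simp [digitLevel]

theorem digitLevel_zero {k : ℕ} {Γ : Finset ℕ} (hΓ : ∀ a ∈ Γ, a < k) :
    digitLevel k Γ 0 = Γ.erase 0 := by
  ext n
  simp only [mem_digitLevel, pow_zero, zero_add, pow_one, Finset.mem_erase]
  constructor
  · rintro ⟨⟨h1, h2⟩, h⟩
    have hn : n ≠ 0 := by omega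
    rw [Nat.digits_of_lt k n hn h2] at h
    exact ⟨hn, h n (by simp)⟩
  · rintro ⟨hn, h⟩
    refine ⟨⟨by omega, hΓ n h⟩, ?_⟩
    rw [Nat.digits_of_lt k n hn (hΓ n h)]
    simpa using h

theorem digitLevel_succ {k : ℕ} (hk : 2 ≤ k) {Γ : Finset ℕ} (hΓ : ∀ a ∈ Γ, a < k) (L : ℕ) :
    digitLevel k Γ (L + 1) =
      (digitLevel k Γ L ×ˢ Γ).image (fun p => p.2 + k * p.1) := by
  have hk0 : 0 < k := by omega
  ext n
  simp only [Finset.mem_image, Finset.mem_product, Prod.exists]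
  constructor
  · intro hn
    obtain ⟨⟨h1, h2⟩, h⟩ := mem_digitLevel.1 hn
    have hn0 : 0 < n := lt_of_lt_of_le (by positivity) h1
    rw [Nat.digits_def' hk hn0] at h
    refine ⟨n / k, n % k, ⟨mem_digitLevel.2 ⟨⟨?_, ?_⟩, ?_⟩, h _ (by simp)⟩, Nat.mod_add_div n k⟩
    · rwa [Nat.le_div_iff_mul_le hk0, ← pow_succ]
    · rwa [Nat.div_lt_iff_lt_mul hk0, ← pow_succ]
    · exact fun c hc => h c (by simp [hc])
  · rintro ⟨m, c, ⟨hm, hc⟩, rfl⟩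
    obtain ⟨⟨h1, h2⟩, h⟩ := mem_digitLevel.1 hm
    have hm0 : 0 < m := lt_of_lt_of_le (by positivity) h1
    have hck := hΓ c hc
    refine mem_digitLevel.2 ⟨⟨?_, ?_⟩, ?_⟩
    · rw [pow_succ']
      exact (Nat.mul_le_mul_left k h1).trans (Nat.le_add_left _ _)
    · rw [pow_succ']
      calc c + k * m < k + k * m := by omega
        _ = k * (m + 1) := by ring
        _ ≤ k * k ^ (L + 1) := Nat.mul_le_mul_left k h2
    · rw [Nat.digits_add k hk c m hck (Or.inr hm0.ne')]
      intro d hd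
      rcases List.mem_cons.1 hd with rfl | hd
      · exact hc
      · exact h d hd

theorem card_digitLevel {k : ℕ} (hk : 2 ≤ k) {Γ : Finset ℕ} (hΓ : ∀ a ∈ Γ, a < k) (L : ℕ) :
    (digitLevel k Γ L).card = (Γ.erase 0).card * Γ.card ^ L := by
  induction L with
  | zero => simp [digitLevel_zero hΓ]
  | succ L ih =>
    rw [digitLevel_succ hk hΓ, Finset.card_image_of_injOn, Finset.card_product, ih, pow_succ,
      mul_assoc]
    rintro ⟨m, c⟩ hp ⟨m', c'⟩ hp' h
    simp only [Finset.coe_product, Set.mem_prod, Finset.mem_coe] at hp hp' h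
    have hc := hΓ c hp.2
    have hc' := hΓ c' hp'.2
    have h1 : c = c' := by
      have := congrArg (· % k) h
      simpa [Nat.add_mul_mod_self_left, Nat.mod_eq_of_lt hc, Nat.mod_eq_of_lt hc'] using this
    subst h1
    have h2 : k * m = k * m' := by omega
    rw [Nat.eq_of_mul_eq_mul_left (by omega) h2]

theorem pairwise_disjoint_digitLevel {k : ℕ} (Γ : Finset ℕ) :
    Pairwise (Function.onFun Disjoint fun L => (digitLevel k Γ L : Set ℕ)) := by
  intro L M hLM
  refine Set.disjoint_left.2 fun n hL hM => hLM ?_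
  have h1 := (mem_digitLevel.1 (Finset.mem_coe.1 hL)).1
  have h2 := (mem_digitLevel.1 (Finset.mem_coe.1 hM)).1
  exact (Nat.log_eq_of_pow_le_of_lt_pow h1.1 h1.2).symm.trans
    (Nat.log_eq_of_pow_le_of_lt_pow h2.1 h2.2)

theorem image_val_digits_eq_iUnion_digitLevel {k : ℕ} (hk : 2 ≤ k) (Γ : Finset ℕ) :
    PNat.val '' {n : ℕ+ | ∀ c ∈ Nat.digits k (n : ℕ), c ∈ Γ} =
      ⋃ L, (digitLevel k Γ L : Set ℕ) := by
  ext n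
  simp only [Set.mem_image, Set.mem_ofPred_eq, Set.mem_iUnion, Finset.mem_coe]
  constructor
  · rintro ⟨n, h, rfl⟩
    exact ⟨Nat.log k n, mem_digitLevel.2
      ⟨⟨Nat.pow_log_le_self k n.ne_zero, Nat.lt_pow_succ_log_self hk _⟩, h⟩⟩
  · rintro ⟨L, h⟩
    obtain ⟨h1, h⟩ := mem_digitLevel.1 h
    exact ⟨⟨n, lt_of_lt_of_le (by positivity) h1.1⟩, h, rfl⟩

theorem tsum_digits_eq_tsum_digitLevel {k : ℕ} (hk : 2 ≤ k) (Γ : Finset ℕ) (f : ℕ → ENNReal) :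
    ∑' n : {n : ℕ+ | ∀ c ∈ Nat.digits k (n : ℕ), c ∈ Γ}, f ((n : ℕ+) : ℕ) =
      ∑' L, ∑ n ∈ digitLevel k Γ L, f n := by
  have h := tsum_image (s := {n : ℕ+ | ∀ c ∈ Nat.digits k (n : ℕ), c ∈ Γ}) f
    (PNat.coe_injective.injOn (s := _))
  have h' : ∑' n : {n : ℕ+ | ∀ c ∈ Nat.digits k (n : ℕ), c ∈ Γ}, f ((n : ℕ+) : ℕ) =
      ∑' n : (PNat.val '' {n : ℕ+ | ∀ c ∈ Nat.digits k (n : ℕ), c ∈ Γ} : Set ℕ), f n := h.symm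
  rw [h', image_val_digits_eq_iUnion_digitLevel hk,
    ENNReal.tsum_biUnion fun L _ M _ h => pairwise_disjoint_digitLevel Γ h]
  exact tsum_congr fun L => Finset.tsum_subtype' _ f

theorem ENNReal.rpow_neg_le_rpow_neg {x y : ENNReal} {s : ℝ} (hs : 0 ≤ s) (h : x ≤ y) :
    y ^ (-s) ≤ x ^ (-s) := by
  rw [ENNReal.rpow_neg, ENNReal.rpow_neg]
  exact ENNReal.inv_le_inv.2 (ENNReal.rpow_le_rpow h hs)

theorem ENNReal.natCast_pow_rpow_neg (k L : ℕ) (s : ℝ) :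
    (((k ^ L : ℕ) : ENNReal)) ^ (-s) = ((k : ENNReal) ^ (-s)) ^ L := by
  push_cast
  rw [← ENNReal.rpow_natCast, ← ENNReal.rpow_natCast, ← ENNReal.rpow_mul, ← ENNReal.rpow_mul,
    mul_comm]

theorem ENNReal.natCast_mul_rpow_neg_lt_one_iff {k N : ℕ} (hk : 2 ≤ k) (hN : 0 < N) (s : ℝ) :
    (N : ENNReal) * (k : ENNReal) ^ (-s) < 1 ↔ Real.log N / Real.log k < s := by
  have hk0 : (0 : ℝ) < k := by positivity
  have hlog : 0 < Real.log k := Real.log_pos (by exact_mod_cast hk)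
  have hN0 : (0 : ℝ) < N := by positivity
  have hpow : (k : ENNReal) ^ (-s) = ENNReal.ofReal ((k : ℝ) ^ (-s)) := by
    rw [← ENNReal.ofReal_rpow_of_pos hk0, ENNReal.ofReal_natCast]
  rw [hpow, ← ENNReal.ofReal_natCast N, ← ENNReal.ofReal_mul hN0.le, ENNReal.ofReal_lt_one,
    Real.rpow_neg hk0.le, ← div_eq_mul_inv, div_lt_one (by positivity), div_lt_iff₀ hlog,
    Real.lt_rpow_iff_log_lt hN0 hk0]

theorem tsum_digitLevel_lt_top_iff {k : ℕ} (hk : 2 ≤ k) {Γ : Finset ℕ} (hΓ : ∀ a ∈ Γ, a < k)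
    (hΓ0 : (Γ.erase 0).Nonempty) {s : ℝ} (hs : 0 ≤ s) :
    ∑' L, ∑ n ∈ digitLevel k Γ L, (n : ENNReal) ^ (-s) < ⊤ ↔
      Real.log Γ.card / Real.log k < s := by
  have hN : 0 < Γ.card := Finset.card_pos.2 (hΓ0.mono (Finset.erase_subset _ _))
  have hcard : ((Γ.erase 0).card : ENNReal) ≠ 0 := by
    simpa using hΓ0.ne_empty
  rw [← ENNReal.natCast_mul_rpow_neg_lt_one_iff hk hN]
  set q : ENNReal := (k : ENNReal) ^ (-s) with hq
  have hq0 : q ≠ 0 := by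
    simp [hq, ENNReal.rpow_eq_zero_iff, show k ≠ 0 by omega]
  constructor
  · refine fun h => lt_of_not_ge fun hr => h.ne (top_unique ?_)
    rw [← ENNReal.tsum_const_eq_top_of_ne_zero (α := ℕ) (mul_ne_zero hcard hq0)]
    refine ENNReal.tsum_le_tsum fun L => ?_
    calc ((Γ.erase 0).card : ENNReal) * q
        ≤ ((Γ.erase 0).card : ENNReal) * q * (Γ.card * q) ^ L :=
          le_mul_of_one_le_right' (one_le_pow₀ hr)
      _ = (digitLevel k Γ L).card • q ^ (L + 1) := by
          rw [card_digitLevel hk hΓ, nsmul_eq_mul]; push_cast; ring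
      _ ≤ _ := Finset.card_nsmul_le_sum _ _ _ fun n hn => by
          rw [hq, ← ENNReal.natCast_pow_rpow_neg]
          exact ENNReal.rpow_neg_le_rpow_neg hs
            (by exact_mod_cast (mem_digitLevel.1 hn).1.2.le)
  · intro hr
    calc ∑' L, ∑ n ∈ digitLevel k Γ L, (n : ENNReal) ^ (-s)
        ≤ ∑' L, ((Γ.erase 0).card : ENNReal) * (Γ.card * q) ^ L := by
          refine ENNReal.tsum_le_tsum fun L => ?_
          refine (Finset.sum_le_card_nsmul _ _ (q ^ L) fun n hn => ?_).trans_eq ?_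
          · rw [hq, ← ENNReal.natCast_pow_rpow_neg]
            exact ENNReal.rpow_neg_le_rpow_neg hs
              (by exact_mod_cast (mem_digitLevel.1 hn).1.1)
          · rw [card_digitLevel hk hΓ, nsmul_eq_mul]; push_cast; ring
      _ = (Γ.erase 0).card * (1 - Γ.card * q)⁻¹ := by
          rw [ENNReal.tsum_mul_left, ENNReal.tsum_geometric]
      _ < ⊤ := ENNReal.mul_lt_top (ENNReal.natCast_lt_top _)
          (ENNReal.inv_lt_top.2 (tsub_pos_of_lt hr))

/-- If `Γ ⊆ Σ = {0, …, k−1}`, `Γ ⊄ {0}`, and `A` is the set of positive integers all of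
whose base-`k` digits lie in `Γ`, then `Dim_ζ(A) = ln|Γ| / ln k`. -/
theorem zetaDim_digit_restriction (k : ℕ) (hk : 2 ≤ k)
    (Γ : Finset ℕ) (hΓ : ∀ a ∈ Γ, a < k) (hΓ0 : ¬ (Γ : Set ℕ) ⊆ {0})
    (A : Set ℕ+) (hA : A = {n : ℕ+ | ∀ c ∈ Nat.digits k (n : ℕ), c ∈ Γ}) :
    zetaDim A = Real.log (Γ.card) / Real.log k := by
  subst hA
  obtain ⟨a, haΓ, ha0⟩ := Set.not_subset.1 hΓ0
  have hne : (Γ.erase 0).Nonempty := ⟨a, Finset.mem_erase.2 ⟨ha0, haΓ⟩⟩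
  have hnonneg : 0 ≤ Real.log Γ.card / Real.log k :=
    div_nonneg (Real.log_natCast_nonneg _) (Real.log_natCast_nonneg _)
  have hset : {s : ℝ | 0 ≤ s ∧
      (∑' n : {n : ℕ+ | ∀ c ∈ Nat.digits k (n : ℕ), c ∈ Γ},
        (((n : ℕ+) : ℕ) : ENNReal) ^ (-s)) < ⊤} = Set.Ioi (Real.log Γ.card / Real.log k) := by
    ext s
    rw [Set.mem_ofPred_eq, Set.mem_Ioi,
      tsum_digits_eq_tsum_digitLevel hk Γ fun n => (n : ENNReal) ^ (-s)]
    constructor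
    · rintro ⟨hs, h⟩
      exact (tsum_digitLevel_lt_top_iff hk hΓ hne hs).1 h
    · intro h
      have hs := hnonneg.trans h.le
      exact ⟨hs, (tsum_digitLevel_lt_top_iff hk hΓ hne hs).2 h⟩
  rw [zetaDim, hset, csInf_Ioi]
end
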